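/- Let μ be the standard Gaussian measure on ℝ. Then for every 1-Lipschitz function f : ℝ → ℝ and all λ ∈ ℝ, ∫ exp(λ(f − ∫f dμ)) dμ ≤ exp(λ²/2); equivalently μ satisfies T₁(1) with respect to the Euclidean distance. -/

import Mathlib

open MeasureTheory ProbabilityTheory

lemma gt1_exp_bound (t : ℝ) : Real.exp t ≤ 1 + t + t ^ 2 / 2 + |t| ^ 3 * Real.exp |t| := by
  have h := Complex.norm_exp_sub_sum_le_norm_mul_exp (t : ℂ) 3
  have e : Complex.exp (t : ℂ) - ∑ m ∈ Finset.range 3, (t : ℂ) ^ m / (m.factorial : ℂ)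
      = ((Real.exp t - (1 + t + t ^ 2 / 2) : ℝ) : ℂ) := by
    simp [Finset.sum_range_succ]
  rw [e, Complex.norm_real, Complex.norm_real, Real.norm_eq_abs, Real.norm_eq_abs] at h
  have := (le_abs_self _).trans h
  linarith

lemma gt1_exp_abs (a : ℝ) (v : NNReal) :
    Integrable (fun x ↦ Real.exp (a * |x|)) (gaussianReal 0 v) :=
  integrable_exp_mul_abs (X := fun x ↦ x) (integrable_exp_mul_gaussianReal a)
    (integrable_exp_mul_gaussianReal (-a))

lemma gt1_abs (v : NNReal) : Integrable (fun x : ℝ ↦ |x|) (gaussianReal 0 v) := by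
  have := (memLp_id_gaussianReal (μ := 0) (v := v) 1)
  have h2 : Integrable (id : ℝ → ℝ) (gaussianReal 0 v) :=
    memLp_one_iff_integrable.1 (by simpa using this)
  exact h2.abs

lemma gt1_lip {f : ℝ → ℝ} (hf : LipschitzWith 1 f) (x y : ℝ) : |f x - f y| ≤ |x - y| := by
  simpa [Real.dist_eq] using hf.dist_le_mul x y

lemma gt1_int {f : ℝ → ℝ} (hf : LipschitzWith 1 f) (v : NNReal) :
    Integrable f (gaussianReal 0 v) := by
  refine ((gt1_abs v).add (integrable_const |f 0|)).mono' hf.continuous.aestronglyMeasurable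
    (Filter.Eventually.of_forall fun x ↦ ?_)
  have h1 := gt1_lip hf x 0
  have h2 := abs_sub_abs_le_abs_sub (f x) (f 0)
  simp only [sub_zero] at h1
  simp only [Pi.add_apply, Real.norm_eq_abs]
  linarith

lemma gt1_int_exp {f : ℝ → ℝ} (hf : LipschitzWith 1 f) (v : NNReal) (l : ℝ) :
    Integrable (fun x ↦ Real.exp (l * f x)) (gaussianReal 0 v) := by
  refine ((gt1_exp_abs |l| v).const_mul (Real.exp (|l| * |f 0|))).mono'
    (by have := hf.continuous; fun_prop) (Filter.Eventually.of_forall fun x ↦ ?_)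
  have h1 := gt1_lip hf x 0
  have h2 := abs_sub_abs_le_abs_sub (f x) (f 0)
  simp only [sub_zero] at h1
  rw [Real.norm_eq_abs, Real.abs_exp, ← Real.exp_add, Real.exp_le_exp, ← mul_add]
  calc l * f x ≤ |l| * |f x| := by rw [← abs_mul]; exact le_abs_self _
    _ ≤ _ := by gcongr; linarith

lemma gt1_step (l : ℝ) : ∃ C : ℝ, ∀ h : ℝ, 0 ≤ h → h ≤ 1 → ∀ f : ℝ → ℝ, LipschitzWith 1 f →
    ∫ x, Real.exp (l * f (h * x)) ∂(gaussianReal 0 1) ≤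
      Real.exp (l ^ 2 * h ^ 2 / 2 + C * h ^ 3) *
        Real.exp (l * ∫ x, f (h * x) ∂(gaussianReal 0 1)) := by
  set c : ℝ := ∫ x, |x| ∂(gaussianReal 0 1) with hc
  have hc0 : 0 ≤ c := integral_nonneg fun x ↦ abs_nonneg x
  set C : ℝ := ∫ x, 6 * Real.exp (2 * |l| * c) * Real.exp (2 * |l| * |x|) ∂(gaussianReal 0 1)
    with hC
  refine ⟨C, fun h h0 h1 f hf ↦ ?_⟩
  have hg : LipschitzWith 1 (fun x ↦ f (h * x)) := by
    refine LipschitzWith.of_dist_le_mul fun x y ↦ ?_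
    rw [Real.dist_eq, Real.dist_eq]
    refine (gt1_lip hf _ _).trans ?_
    rw [← mul_sub, abs_mul, abs_of_nonneg h0]
    simpa using mul_le_mul_of_nonneg_right h1 (abs_nonneg (x - y))
  set g : ℝ → ℝ := fun x ↦ f (h * x) with hgdef
  have hgc := hg.continuous
  set m : ℝ := ∫ x, g x ∂(gaussianReal 0 1) with hm
  have hgi : Integrable g (gaussianReal 0 1) := gt1_int hg 1
  have hg0 : ∀ x, |g x - g 0| ≤ h * |x| := fun x ↦ by
    have := gt1_lip hf (h * x) (h * 0)
    rwa [← mul_sub, abs_mul, abs_of_nonneg h0, sub_zero] at this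
  have hm0 : |m - g 0| ≤ h * c := by
    have e : m - g 0 = ∫ x, (g x - g 0) ∂(gaussianReal 0 1) := by
      rw [integral_sub hgi (integrable_const _)]; simp [hm]
    rw [e, hc, ← integral_const_mul]
    refine (abs_integral_le_integral_abs).trans ?_
    exact integral_mono (hgi.sub (integrable_const _)).abs ((gt1_abs 1).const_mul h) hg0
  have hW : ∀ x, |g x - m| ≤ h * (|x| + c) := fun x ↦ by
    have e : g x - m = (g x - g 0) - (m - g 0) := by ring
    rw [e]
    have := abs_sub (g x - g 0) (m - g 0)
    linarith [hg0 x]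
  have hsq : Integrable (fun x : ℝ ↦ x ^ 2) (gaussianReal 0 1) :=
    (memLp_id_gaussianReal (μ := 0) (v := 1) 2).integrable_sq
  have hsqv : ∫ x : ℝ, x ^ 2 ∂(gaussianReal 0 1) = 1 := by
    have := variance_fun_id_gaussianReal (μ := 0) (v := 1)
    rw [variance_eq_integral (by fun_prop)] at this
    simpa using this
  have hg2 : Integrable (fun x ↦ (g x - g 0) ^ 2) (gaussianReal 0 1) := by
    refine (hsq.const_mul (h ^ 2)).mono' (by fun_prop) (Filter.Eventually.of_forall fun x ↦ ?_)
    rw [Real.norm_eq_abs, abs_pow, ← mul_pow, ← sq_abs (h * x), abs_mul, abs_of_nonneg h0]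
    exact pow_le_pow_left₀ (abs_nonneg _) (hg0 x) 2
  have hW2i : Integrable (fun x ↦ (g x - m) ^ 2) (gaussianReal 0 1) := by
    have e : (fun x ↦ (g x - m) ^ 2)
        = fun x ↦ (g x - g 0) ^ 2 + (2 * (g 0 - m) * (g x - g 0) + (g 0 - m) ^ 2) := by
      ext x; ring
    rw [e]
    exact hg2.add (((hgi.sub (integrable_const _)).const_mul _).add (integrable_const _))
  have hW2 : ∫ x, (g x - m) ^ 2 ∂(gaussianReal 0 1) ≤ h ^ 2 := by
    have h1 := variance_le_expectation_sq (μ := gaussianReal 0 1) (X := fun x ↦ g x - g 0)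
      (by fun_prop)
    rw [variance_sub_const (by fun_prop), variance_eq_integral (by fun_prop)] at h1
    refine h1.trans ?_
    calc ∫ x, (g x - g 0) ^ 2 ∂(gaussianReal 0 1)
        ≤ ∫ x, h ^ 2 * x ^ 2 ∂(gaussianReal 0 1) := by
          refine integral_mono hg2 (hsq.const_mul _) fun x ↦ ?_
          show (g x - g 0) ^ 2 ≤ h ^ 2 * x ^ 2
          rw [← sq_abs (g x - g 0), ← mul_pow, ← sq_abs (h * x), abs_mul, abs_of_nonneg h0]
          exact pow_le_pow_left₀ (abs_nonneg _) (hg0 x) 2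
      _ = h ^ 2 := by rw [integral_const_mul, hsqv, mul_one]
  have hKi : Integrable (fun x ↦ 6 * Real.exp (2 * |l| * c) * Real.exp (2 * |l| * |x|))
      (gaussianReal 0 1) := (gt1_exp_abs (2 * |l|) 1).const_mul _
  have hpt : ∀ x, Real.exp (l * (g x - m)) ≤ 1 + l * (g x - m) + l ^ 2 / 2 * (g x - m) ^ 2
      + h ^ 3 * (6 * Real.exp (2 * |l| * c) * Real.exp (2 * |l| * |x|)) := fun x ↦ by
    have b := gt1_exp_bound (l * (g x - m))
    set s := |l| * (|x| + c) with hs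
    have hs0 : 0 ≤ s := by positivity
    have hts : |l * (g x - m)| ≤ h * s := by
      rw [abs_mul]
      calc |l| * |g x - m| ≤ |l| * (h * (|x| + c)) := by gcongr; exact hW x
        _ = h * s := by ring
    have hts' : |l * (g x - m)| ≤ s := hts.trans (mul_le_of_le_one_left hs0 h1)
    have hcube : s ^ 3 ≤ 6 * Real.exp s := by
      have := Real.pow_div_factorial_le_exp s hs0 3
      norm_num [Nat.factorial] at this
      linarith
    have : |l * (g x - m)| ^ 3 * Real.exp |l * (g x - m)|
        ≤ h ^ 3 * (6 * Real.exp (2 * |l| * c) * Real.exp (2 * |l| * |x|)) := by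
      calc _ ≤ (h * s) ^ 3 * Real.exp s := by gcongr
        _ = h ^ 3 * (s ^ 3 * Real.exp s) := by ring
        _ ≤ h ^ 3 * (6 * Real.exp s * Real.exp s) := by gcongr
        _ = _ := by
          rw [mul_assoc 6, mul_assoc 6, ← Real.exp_add, ← Real.exp_add, hs]
          ring_nf
    nlinarith
  have hWi : Integrable (fun x ↦ g x - m) (gaussianReal 0 1) := hgi.sub (integrable_const _)
  have hW0 : ∫ x, (g x - m) ∂(gaussianReal 0 1) = 0 := by
    rw [integral_sub hgi (integrable_const _)]; simp [hm]
  have hexpi : Integrable (fun x ↦ Real.exp (l * (g x - m))) (gaussianReal 0 1) := by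
    have e : (fun x ↦ Real.exp (l * (g x - m)))
        = fun x ↦ Real.exp (-(l * m)) * Real.exp (l * g x) := by
      ext x; rw [← Real.exp_add]; ring_nf
    rw [e]; exact (gt1_int_exp hg 1 l).const_mul _
  have i1 : Integrable (fun x ↦ 1 + l * (g x - m)) (gaussianReal 0 1) :=
    (integrable_const _).add (hWi.const_mul l)
  have i2 : Integrable (fun x ↦ 1 + l * (g x - m) + l ^ 2 / 2 * (g x - m) ^ 2)
      (gaussianReal 0 1) := i1.add (hW2i.const_mul _)
  have main : ∫ x, Real.exp (l * (g x - m)) ∂(gaussianReal 0 1)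
      ≤ Real.exp (l ^ 2 * h ^ 2 / 2 + C * h ^ 3) := by
    refine (integral_mono hexpi (i2.add (hKi.const_mul (h ^ 3))) hpt).trans ?_
    simp only [Pi.add_apply]
    rw [integral_add i2 (hKi.const_mul (h ^ 3)), integral_add i1 (hW2i.const_mul _),
      integral_add (integrable_const _) (hWi.const_mul l), integral_const_mul, integral_const_mul,
      integral_const_mul, hW0, ← hC]
    have := Real.add_one_le_exp (l ^ 2 * h ^ 2 / 2 + C * h ^ 3)
    have h3 : l ^ 2 / 2 * ∫ x, (g x - m) ^ 2 ∂(gaussianReal 0 1) ≤ l ^ 2 / 2 * h ^ 2 := by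
      gcongr
    simp only [integral_const, probReal_univ, smul_eq_mul]
    linarith
  calc ∫ x, Real.exp (l * g x) ∂(gaussianReal 0 1)
      = (∫ x, Real.exp (l * (g x - m)) ∂(gaussianReal 0 1)) * Real.exp (l * m) := by
        rw [← integral_mul_const]
        congr 1; ext x; rw [← Real.exp_add]; ring_nf
    _ ≤ _ := by gcongr

lemma gt1_scale (h : ℝ) (v : NNReal) (hv : (v : ℝ) = h ^ 2) {F : ℝ → ℝ} (hF : Continuous F) :
    ∫ x, F x ∂(gaussianReal 0 v) = ∫ x, F (h * x) ∂(gaussianReal 0 1) := by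
  have e := gaussianReal_map_const_mul (μ := 0) (v := 1) h
  have : (NNReal.mk (h ^ 2) (sq_nonneg _) * 1 : NNReal) = v := by
    ext; simp [hv]
  rw [this, mul_zero] at e
  rw [← e, integral_map (by fun_prop) (by fun_prop)]

lemma gt1_iter (l A : ℝ) (v : NNReal)
    (H : ∀ f : ℝ → ℝ, LipschitzWith 1 f → ∫ x, Real.exp (l * f x) ∂(gaussianReal 0 v)
      ≤ Real.exp A * Real.exp (l * ∫ x, f x ∂(gaussianReal 0 v))) (k : ℕ) :
    ∀ f : ℝ → ℝ, LipschitzWith 1 f → ∫ x, Real.exp (l * f x) ∂(gaussianReal 0 (k * v))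
      ≤ Real.exp (k * A) * Real.exp (l * ∫ x, f x ∂(gaussianReal 0 (k * v))) := by
  induction k with
  | zero => intro f hf; simp [gaussianReal_zero_var]
  | succ k ih =>
    intro f hf
    have e : gaussianReal 0 ((k + 1 : ℕ) * v) = (gaussianReal 0 (k * v)) ∗ (gaussianReal 0 v) := by
      rw [gaussianReal_conv_gaussianReal]; congr 1 <;> push_cast <;> ring
    have i1 := gt1_int hf ((k + 1 : ℕ) * v)
    have i2 := gt1_int_exp hf ((k + 1 : ℕ) * v) l
    rw [e] at i1 i2 ⊢
    rw [integral_conv i1, integral_conv i2]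
    have hsh : ∀ x, LipschitzWith 1 (fun y ↦ f (x + y)) := fun x ↦
      LipschitzWith.of_dist_le_mul fun y z ↦ by
        simpa using hf.dist_le_mul (x + y) (x + z)
    have hG : LipschitzWith 1 (fun x ↦ ∫ y, f (x + y) ∂(gaussianReal 0 v)) := by
      refine LipschitzWith.of_dist_le_mul fun x z ↦ ?_
      rw [Real.dist_eq, Real.dist_eq, ← integral_sub (gt1_int (hsh x) v) (gt1_int (hsh z) v)]
      refine abs_integral_le_integral_abs.trans ?_
      have := integral_mono (μ := gaussianReal 0 v)
        ((gt1_int (hsh x) v).sub (gt1_int (hsh z) v)).abs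
        (integrable_const |x - z|) (fun y ↦ by
          simpa using gt1_lip hf (x + y) (z + y))
      simpa using this
    have i3 := ((integrable_conv_iff i2.1).1 i2).2
    simp only [Real.norm_eq_abs, Real.abs_exp] at i3
    calc _ ≤ ∫ x, Real.exp A * Real.exp (l * ∫ y, f (x + y) ∂(gaussianReal 0 v))
          ∂(gaussianReal 0 (k * v)) :=
          integral_mono i3 ((gt1_int_exp hG _ l).const_mul _) fun x ↦ H _ (hsh x)
      _ = Real.exp A * ∫ x, Real.exp (l * ∫ y, f (x + y) ∂(gaussianReal 0 v))
          ∂(gaussianReal 0 (k * v)) := integral_const_mul _ _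
      _ ≤ Real.exp A * (Real.exp (k * A) * Real.exp (l * ∫ x, ∫ y, f (x + y) ∂(gaussianReal 0 v)
          ∂(gaussianReal 0 (k * v)))) := by gcongr; exact ih _ hG
      _ = _ := by
        rw [← mul_assoc, ← Real.exp_add]; congr 2; push_cast; ring

/-- The standard Gaussian measure on `ℝ` satisfies the Bobkov–Götze Gaussian concentration
bound with constant `C = 1`: for every 1-Lipschitz `f` and every `λ ∈ ℝ`,
`∫ exp(λ(f − ∫ f dμ)) dμ ≤ exp(λ²/2)`. -/
theorem gaussian_t1 (f : ℝ → ℝ) (hf : LipschitzWith 1 f) (l : ℝ) :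
    ∫ x, Real.exp (l * (f x - ∫ y, f y ∂(gaussianReal 0 1))) ∂(gaussianReal 0 1)
      ≤ Real.exp (l ^ 2 / 2) := by
  obtain ⟨C, hC⟩ := gt1_step l
  set m : ℝ := ∫ y, f y ∂(gaussianReal 0 1) with hm
  have key : ∀ n : ℕ, ∫ x, Real.exp (l * (f x - m)) ∂(gaussianReal 0 1)
      ≤ Real.exp (l ^ 2 / 2 + C * (1 / √((n : ℝ) + 1))) := by
    intro n
    have hn : (0 : ℝ) < (n : ℝ) + 1 := by positivity
    set h : ℝ := 1 / √((n : ℝ) + 1) with hh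
    have h0 : 0 ≤ h := by positivity
    have hsq : h ^ 2 = 1 / ((n : ℝ) + 1) := by rw [hh, div_pow, Real.sq_sqrt hn.le, one_pow]
    have h1 : h ≤ 1 := by
      rw [hh, div_le_one (by positivity), Real.one_le_sqrt]
      linarith [(Nat.cast_nonneg n : (0 : ℝ) ≤ n)]
    have hnh : ((n : ℝ) + 1) * h ^ 2 = 1 := by rw [hsq]; field_simp
    let v : NNReal := NNReal.mk (h ^ 2) (sq_nonneg _)
    have hv : (v : ℝ) = h ^ 2 := rfl
    have it := gt1_iter l (l ^ 2 * h ^ 2 / 2 + C * h ^ 3) v (fun F hF ↦ by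
      have hFc := hF.continuous
      rw [gt1_scale h v hv hFc,
        gt1_scale h v hv (F := fun x ↦ Real.exp (l * F x)) (by fun_prop)]
      exact hC h h0 h1 F hF) (n + 1) f hf
    have hv1 : ((n + 1 : ℕ) : NNReal) * v = 1 := by
      ext; push_cast; rw [hv, hnh]
    rw [hv1, ← hm] at it
    have eA : ((n + 1 : ℕ) : ℝ) * (l ^ 2 * h ^ 2 / 2 + C * h ^ 3) = l ^ 2 / 2 + C * h := by
      push_cast
      linear_combination (l ^ 2 / 2 + C * h) * hnh
    rw [eA] at it
    calc ∫ x, Real.exp (l * (f x - m)) ∂(gaussianReal 0 1)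
        = (∫ x, Real.exp (l * f x) ∂(gaussianReal 0 1)) * Real.exp (-(l * m)) := by
          rw [← integral_mul_const]
          congr 1; ext x; rw [← Real.exp_add]; ring_nf
      _ ≤ (Real.exp (l ^ 2 / 2 + C * h) * Real.exp (l * m)) * Real.exp (-(l * m)) := by gcongr
      _ = _ := by rw [mul_assoc, ← Real.exp_add, add_neg_cancel, Real.exp_zero, mul_one]
  have hlim0 : Filter.Tendsto (fun n : ℕ ↦ 1 / √((n : ℝ) + 1)) Filter.atTop (nhds 0) := by
    have : Filter.Tendsto (fun n : ℕ ↦ √(1 / ((n : ℝ) + 1))) Filter.atTop (nhds √0) :=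
      (Real.continuous_sqrt.tendsto 0).comp tendsto_one_div_add_atTop_nhds_zero_nat
    simpa using this
  have hlim : Filter.Tendsto (fun n : ℕ ↦ Real.exp (l ^ 2 / 2 + C * (1 / √((n : ℝ) + 1))))
      Filter.atTop (nhds (Real.exp (l ^ 2 / 2))) := by
    have := (Real.continuous_exp.tendsto _).comp ((hlim0.const_mul C).const_add (l ^ 2 / 2))
    simpa [Function.comp_def] using this
  exact ge_of_tendsto' hlim key
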